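/- arXiv:1803.04409 — 2 statements merged into one kernel-verified Lean document; each statement's English description precedes it below -/
import Mathlib

section
/- The exterior differential squares to zero: for every ω ∈ Ω^r, applying the Cartan formula to the form dω ∈ Ω^{r+1} yields d(dω) = 0 as a map 𝔇^{r+2} → A. -/
/-- The raw Cartan formula for the exterior differential: for an `r`-argument map
`ω : 𝔇^r → A` on the derivations `𝔇 = Der_𝔽(A)`, `cartanD ω : 𝔇^{r+1} → A` is
`dω(X_0,…,X_r) = (r+1)⁻¹ ( Σ_s (−1)^s X_s (ω(X_0,…,X̂_s,…,X_r))
  + Σ_{s<t} (−1)^{s+t} ω(⁅X_s,X_t⁆, X_0,…,X̂_s,…,X̂_t,…,X_r) )`. -/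
noncomputable def cartanD {𝔽 : Type*} [Field 𝔽] [CharZero 𝔽]
    {A : Type*} [CommRing A] [Algebra 𝔽 A] {r : ℕ}
    (ω : (Fin r → Derivation 𝔽 A A) → A) :
    (Fin (r + 1) → Derivation 𝔽 A A) → A :=
  fun X =>
    ((r + 1 : 𝔽))⁻¹ • (
      (∑ s : Fin (r + 1), (-1 : A) ^ (s : ℕ) * X s (ω (s.removeNth X))) +
      ∑ s : Fin (r + 1), ∑ t : Fin (r + 1),
        if s < t then
          (-1 : A) ^ ((s : ℕ) + (t : ℕ)) *
            ω (fun u : Fin r =>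
              if (u : ℕ) = 0 then ⁅X s, X t⁆
              else X ⟨if (u : ℕ) - 1 < (s : ℕ) then (u : ℕ) - 1
                      else if (u : ℕ) < (t : ℕ) then (u : ℕ) else (u : ℕ) + 1,
                      by have h1 := u.isLt; split
                         · omega
                         · split <;> omega⟩)
        else 0)

/-- The interior product `i_X ω (X_1,…,X_{r-1}) = r · ω(X, X_1,…,X_{r-1})` (raw form). -/
def iProdRaw {𝔽 : Type*} [Field 𝔽] [CharZero 𝔽]
    {A : Type*} [CommRing A] [Algebra 𝔽 A] {r : ℕ}
    (X : Derivation 𝔽 A A) (ω : (Fin r → Derivation 𝔽 A A) → A) :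
    (Fin (r - 1) → Derivation 𝔽 A A) → A :=
  fun Y => (r : A) * ω (fun u => if h : (u : ℕ) = 0 then X
    else Y ⟨(u : ℕ) - 1, by have h1 := u.isLt; omega⟩)

/-- The Lie derivative
`L_X ω (X_1,…,X_r) = X (ω (X_1,…,X_r)) − Σ_s ω(X_1,…,⁅X,X_s⁆,…,X_r)` (raw form). -/
def lieDerivRaw {𝔽 : Type*} [Field 𝔽] [CharZero 𝔽]
    {A : Type*} [CommRing A] [Algebra 𝔽 A] {r : ℕ}
    (X : Derivation 𝔽 A A) (ω : (Fin r → Derivation 𝔽 A A) → A) :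
    (Fin r → Derivation 𝔽 A A) → A :=
  fun Y => X (ω Y) - ∑ s : Fin r, ω (Function.update Y s ⁅X, Y s⁆)

universe u

/-- A bundled Lie ring module. -/
structure CLMod (g : Type u) [LieRing g] where
  T : Type u
  grp : AddCommGroup T
  lie : LieRingModule g T

/-- Iterated additive maps `g → g → ⋯ → A`, with their Lie module structure. -/
def CForm.bundle (g : Type u) [LieRing g] (A : Type u) [iA : AddCommGroup A]
    [iL : LieRingModule g A] : ℕ → CLMod g
  | 0 => ⟨A, iA, iL⟩
  | r + 1 =>
    letI := (CForm.bundle g A r).grp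
    letI := (CForm.bundle g A r).lie
    ⟨g →ₗ[ℤ] (CForm.bundle g A r).T, inferInstance, LinearMap.instLieRingModule⟩

section CForms

variable {g : Type u} [LieRing g] {A : Type u} [AddCommGroup A] [LieRingModule g A]

/-- The carrier of the iterated additive maps. -/
def CForm (g : Type u) [LieRing g] (A : Type u) [AddCommGroup A]
    [LieRingModule g A] (r : ℕ) : Type u := (CForm.bundle g A r).T

instance CForm.instGrp (r : ℕ) : AddCommGroup (CForm g A r) := (CForm.bundle g A r).grp

instance CForm.instLie (r : ℕ) : LieRingModule g (CForm g A r) := (CForm.bundle g A r).lie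

namespace CForm

/-- Plug in the first argument. -/
def ap {r : ℕ} : CForm g A (r + 1) →+ g →+ CForm g A r where
  toFun ω := LinearMap.toAddMonoidHom (show g →ₗ[ℤ] CForm g A r from ω)
  map_zero' := rfl
  map_add' _ _ := rfl

/-- Build a form from its curried version. -/
def mk {r : ℕ} (f : g →+ CForm g A r) : CForm g A (r + 1) :=
  (AddMonoidHom.toIntLinearMap f : g →ₗ[ℤ] CForm g A r)

@[simp] theorem ap_mk {r : ℕ} (f : g →+ CForm g A r) : ap (mk f) = f := rfl

theorem extAp {r : ℕ} {ω η : CForm g A (r + 1)} (h : ∀ Y, ap ω Y = ap η Y) : ω = η :=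
  LinearMap.ext (f := (show g →ₗ[ℤ] CForm g A r from ω))
    (g := (show g →ₗ[ℤ] CForm g A r from η)) h

theorem ap_lie {r : ℕ} (X : g) (ω : CForm g A (r + 1)) (Y : g) :
    ap ⁅X, ω⁆ Y = ⁅X, ap ω Y⁆ - ap ω ⁅X, Y⁆ := rfl

/-- The value of a form of degree zero. -/
def val : CForm g A 0 →+ A := AddMonoidHom.id A

theorem val_lie (X : g) (ω : CForm g A 0) : val ⁅X, ω⁆ = ⁅X, val ω⁆ := rfl

/-- The unnormalised differential, defined through the magic formula. -/
def D : (r : ℕ) → CForm g A r →+ CForm g A (r + 1)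
  | 0 => AddMonoidHom.mk' (fun ω => mk (AddMonoidHom.mk' (fun Y => ⁅Y, ω⁆)
          (fun a b => add_lie a b ω)))
        (fun a b => extAp fun Y => lie_add Y a b)
  | r + 1 => AddMonoidHom.mk' (fun ω => mk (AddMonoidHom.mk' (fun Y => ⁅Y, ω⁆ - D r (ap ω Y))
          (fun a b => by simp only [add_lie, map_add]; abel)))
        (fun a b => extAp fun Y => by
          simp only [map_add, ap_mk, AddMonoidHom.mk'_apply, AddMonoidHom.add_apply, lie_add]
          abel)

theorem ap_D_zero (ω : CForm g A 0) (Y : g) : ap (D 0 ω) Y = ⁅Y, ω⁆ := rfl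

theorem ap_D_succ {r : ℕ} (ω : CForm g A (r + 1)) (Y : g) :
    ap (D (r + 1) ω) Y = ⁅Y, ω⁆ - D r (ap ω Y) := rfl

theorem D_lie : ∀ {r : ℕ} (X : g) (ω : CForm g A r), D r ⁅X, ω⁆ = ⁅X, D r ω⁆
  | 0, X, ω => extAp fun Y => by
      rw [ap_lie, ap_D_zero, ap_D_zero, ap_D_zero, lie_lie]; abel
  | r + 1, X, ω => extAp fun Y => by
      rw [ap_lie, ap_D_succ, ap_D_succ, ap_D_succ, lie_lie, ap_lie, map_sub, D_lie, lie_sub]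
      abel

theorem D_D : ∀ {r : ℕ} (ω : CForm g A r), D (r + 1) (D r ω) = 0
  | 0, ω => extAp fun Y => by
      rw [ap_D_succ, ap_D_zero, D_lie]; simp
  | r + 1, ω => extAp fun Y => by
      rw [ap_D_succ, ap_D_succ, map_sub, D_lie, D_D]; simp

/-- Alternating forms. -/
def Alt : (r : ℕ) → CForm g A r → Prop
  | 0, _ => True
  | 1, _ => True
  | r + 2, ω => (∀ Y, ap (ap ω Y) Y = 0) ∧ ∀ Y, Alt (r + 1) (ap ω Y)

theorem Alt.ap {r : ℕ} {ω : CForm g A (r + 1)} (h : Alt (r + 1) ω) (Y : g) :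
    Alt r (CForm.ap ω Y) := by
  cases r with
  | zero => trivial
  | succ r => exact h.2 Y

theorem Alt.swap {r : ℕ} {ω : CForm g A (r + 2)} (h : Alt (r + 2) ω) (Y Z : g) :
    CForm.ap (CForm.ap ω Y) Z = - CForm.ap (CForm.ap ω Z) Y := by
  have := h.1 (Y + Z)
  simp only [map_add, AddMonoidHom.add_apply, h.1, zero_add, add_zero] at this
  exact eq_neg_of_add_eq_zero_right this

theorem Alt.sub : ∀ {r : ℕ} {ω η : CForm g A r}, Alt r ω → Alt r η → Alt r (ω - η)
  | 0, _, _, _, _ => trivial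
  | 1, _, _, _, _ => trivial
  | r + 2, ω, η, h, k => by
      refine ⟨fun Y => ?_, fun Y => ?_⟩
      · simp [h.1, k.1]
      · rw [map_sub]; exact (h.2 Y).sub (k.2 Y)

theorem Alt.lie : ∀ {r : ℕ} {ω : CForm g A r} (X : g), Alt r ω → Alt r ⁅X, ω⁆
  | 0, _, _, _ => trivial
  | 1, _, _, _ => trivial
  | r + 2, ω, X, h => by
      refine ⟨fun Y => ?_, fun Y => ?_⟩
      · rw [ap_lie, map_sub, AddMonoidHom.sub_apply, ap_lie, h.1, h.swap ⁅X, Y⁆ Y]; simp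
      · rw [ap_lie]; exact ((h.2 Y).lie X).sub (h.2 _)

theorem Alt.D : ∀ {r : ℕ} {ω : CForm g A r}, Alt r ω → Alt (r + 1) (D r ω)
  | 0, _, _ => trivial
  | 1, ω, h => by
      refine ⟨fun Y => ?_, fun Y => trivial⟩
      rw [ap_D_succ, map_sub, AddMonoidHom.sub_apply, ap_lie, ap_D_zero]; simp
  | r + 2, ω, h => by
      refine ⟨fun Y => ?_, fun Y => ?_⟩
      · rw [ap_D_succ, map_sub, AddMonoidHom.sub_apply, ap_lie, ap_D_succ, h.1]; simp
      · rw [ap_D_succ]; exact (h.lie Y).sub (h.ap Y).D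

/-- Evaluate a form on a tuple. -/
def ev : {r : ℕ} → CForm g A r → (Fin r → g) → A
  | 0, ω, _ => val ω
  | _ + 1, ω, X => ev (ap ω (X 0)) (Fin.tail X)

theorem ev_cons {r : ℕ} (ω : CForm g A (r + 1)) (Y : g) (X : Fin r → g) :
    ev ω (Fin.cons Y X) = ev (ap ω Y) X := rfl

theorem ev_sub : ∀ {r : ℕ} (ω η : CForm g A r) (X : Fin r → g),
    ev (ω - η) X = ev ω X - ev η X
  | 0, ω, η, X => map_sub val ω η
  | r + 1, ω, η, X => by simp only [ev, map_sub, AddMonoidHom.sub_apply, ev_sub]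

theorem ev_zero {r : ℕ} (X : Fin r → g) : ev (0 : CForm g A r) X = 0 := by
  simpa using ev_sub (0 : CForm g A r) 0 X

theorem ev_neg {r : ℕ} (ω : CForm g A r) (X : Fin r → g) : ev (-ω) X = - ev ω X := by
  simpa [ev_zero] using ev_sub 0 ω X

theorem ev_lie : ∀ {r : ℕ} (Y : g) (ω : CForm g A r) (X : Fin r → g),
    ev ⁅Y, ω⁆ X = ⁅Y, ev ω X⁆ - ∑ s, ev ω (Function.update X s ⁅Y, X s⁆)
  | 0, Y, ω, X => by simp [ev, val_lie]
  | r + 1, Y, ω, X => by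
      obtain ⟨Z, X, rfl⟩ : ∃ Z V, X = Fin.cons Z V :=
        ⟨X 0, Fin.tail X, (Fin.cons_self_tail X).symm⟩
      rw [ev_cons, ev_cons, ap_lie, ev_sub, ev_lie, Fin.sum_univ_succ]
      simp only [Fin.cons_zero, Fin.cons_succ, Fin.update_cons_zero, ← Fin.cons_update, ev_cons]
      abel

theorem ev_move : ∀ {r : ℕ} {ω : CForm g A (r + 1)} (_ : Alt (r + 1) ω) (W : g)
    (t : Fin (r + 1)) (X : Fin (r + 1) → g),
    ev ω (Fin.cons W (t.removeNth X)) = (-1 : ℤ) ^ (t : ℕ) • ev ω (Function.update X t W) := by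
  intro r
  induction r with
  | zero =>
    intro ω h W t X
    obtain ⟨Z, X, rfl⟩ : ∃ Z V, X = Fin.cons Z V :=
      ⟨X 0, Fin.tail X, (Fin.cons_self_tail X).symm⟩
    fin_cases t
    simp [ev]
  | succ r ih =>
    intro ω h W t X
    obtain ⟨Z, X, rfl⟩ : ∃ Z V, X = Fin.cons Z V :=
      ⟨X 0, Fin.tail X, (Fin.cons_self_tail X).symm⟩
    induction t using Fin.cases with
    | zero => simp [Fin.update_cons_zero]
    | succ t =>
      have e : (t.succ).removeNth (Fin.cons Z X : Fin (r + 2) → g)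
          = Fin.cons Z (t.removeNth X) := by
        funext i
        induction i using Fin.cases <;> simp [Fin.removeNth]
      rw [e, ev_cons, ev_cons, h.swap, ev_neg, ← ev_cons, ih (h.ap Z), ← Fin.cons_update, ev_cons]
      simp [pow_succ]

/-- The tuple `⁅X_s, X_t⁆, X_0, …, X_r` without `X_s`, `X_t`. -/
def br {r : ℕ} (X : Fin (r + 1) → g) (s t : Fin (r + 1)) : Fin r → g :=
  fun u : Fin r =>
              if (u : ℕ) = 0 then ⁅X s, X t⁆
              else X ⟨if (u : ℕ) - 1 < (s : ℕ) then (u : ℕ) - 1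
                      else if (u : ℕ) < (t : ℕ) then (u : ℕ) else (u : ℕ) + 1,
                      by have h1 := u.isLt; split
                         · omega
                         · split <;> omega⟩

theorem br_zero {r : ℕ} (Y : g) (X : Fin (r + 1) → g) (t : Fin (r + 1)) :
    br (Fin.cons Y X : Fin (r + 2) → g) 0 t.succ = Fin.cons ⁅Y, X t⁆ (t.removeNth X) := by
  funext u
  induction u using Fin.cases with
  | zero => simp [br]
  | succ u =>
    simp only [br, Fin.val_succ, Fin.cons_succ, Fin.removeNth]
    rw [if_neg (by omega), ← Fin.cons_succ (α := fun _ => g) Y X (t.succAbove u)]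
    congr 1
    ext
    simp [Fin.succAbove, Fin.lt_def]
    split_ifs <;> simp

theorem br_succ {r : ℕ} (Y : g) (X : Fin (r + 2) → g) (s t : Fin (r + 2)) :
    br (Fin.cons Y X : Fin (r + 3) → g) s.succ t.succ
      = Fin.cons ⁅X s, X t⁆ (Fin.cons Y (Fin.tail (br X s t))) := by
  funext u
  induction u using Fin.cases with
  | zero => simp [br]
  | succ u =>
    induction u using Fin.cases with
    | zero => 
      simp only [br, Fin.val_succ, Fin.cons_succ, Fin.cons_zero]
      rw [if_neg (by omega), ← Fin.cons_zero (α := fun _ => g) Y X]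
      congr 1
    | succ u =>
      simp only [br, Fin.val_succ, Fin.cons_succ, Fin.tail]
      rw [if_neg (show ¬ ((u : ℕ) + 1 + 1 = 0) by omega), if_neg (show ¬ ((u : ℕ) + 1 = 0) by omega),
        ← Fin.cons_succ (α := fun _ => g) Y X]
      congr 1
      ext
      simp
      split_ifs <;> omega

theorem br_head {r : ℕ} (X : Fin (r + 2) → g) (s t : Fin (r + 2)) :
    br X s t = Fin.cons ⁅X s, X t⁆ (Fin.tail (br X s t)) := by
  conv_lhs => rw [← Fin.cons_self_tail (br X s t)]
  rfl

/-- The unnormalised Cartan formula. -/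
def C {r : ℕ} (F : (Fin r → g) → A) (X : Fin (r + 1) → g) : A :=
  (∑ s : Fin (r + 1), (-1 : ℤ) ^ (s : ℕ) • ⁅X s, F (s.removeNth X)⁆) +
      ∑ s : Fin (r + 1), ∑ t : Fin (r + 1),
        if s < t then (-1 : ℤ) ^ ((s : ℕ) + (t : ℕ)) • F (br X s t) else 0

theorem C_ev : ∀ {r : ℕ} {ω : CForm g A r} (_ : Alt r ω) (X : Fin (r + 1) → g),
    C (ev ω) X = ev (D r ω) X := by
  intro r
  induction r with
  | zero =>
    intro ω h X
    simp [C, ev, ap_D_zero, val_lie]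
  | succ r ih =>
    intro ω h X
    obtain ⟨Y, X, rfl⟩ : ∃ Z V, X = Fin.cons Z V :=
      ⟨X 0, Fin.tail X, (Fin.cons_self_tail X).symm⟩
    rw [ev_cons, ap_D_succ, ev_sub, ev_lie, ← ih (h.ap Y), C, C]
    have e (t) : (Fin.succ t).removeNth (Fin.cons Y X : Fin (r + 2) → g)
          = Fin.cons Y (t.removeNth X) := by
        cases r with
        | zero => funext i; fin_cases t; fin_cases i; simp [Fin.removeNth]
        | succ r => 
          funext i
          induction i using Fin.cases <;> simp [Fin.removeNth]
    have b (s t : Fin (r + 1)) (hst : s < t) :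
        ev ω (br (Fin.cons Y X : Fin (r + 2) → g) s.succ t.succ)
          = - ev (ap ω Y) (br X s t) := by
      cases r with
      | zero => omega
      | succ r =>
        rw [br_succ, ev_cons, ev_cons, h.swap, ev_neg, br_head X s t, ev_cons, Fin.tail_cons]
    have bsum : (∑ s : Fin (r + 1), ∑ t : Fin (r + 1),
        if s.succ < t.succ then (-1 : ℤ) ^ ((s.succ : ℕ) + (t.succ : ℕ)) •
          ev ω (br (Fin.cons Y X : Fin (r + 2) → g) s.succ t.succ) else 0)
        = - ∑ s : Fin (r + 1), ∑ t : Fin (r + 1),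
        if s < t then (-1 : ℤ) ^ ((s : ℕ) + (t : ℕ)) • ev (ap ω Y) (br X s t) else 0 := by
      simp only [← Finset.sum_neg_distrib]
      refine Finset.sum_congr rfl fun s _ => Finset.sum_congr rfl fun t _ => ?_
      by_cases hst : s < t
      · rw [if_pos hst, if_pos (Fin.succ_lt_succ_iff.2 hst), b s t hst]
        simp only [Fin.val_succ]
        rw [show (s : ℕ) + 1 + (t + 1) = s + t + 2 by ring, pow_add]
        simp
      · rw [if_neg hst, if_neg (by simpa using hst)]; simp
    have m (t : Fin (r + 1)) : ev ω (br (Fin.cons Y X : Fin (r + 2) → g) 0 t.succ)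
        = (-1 : ℤ) ^ (t : ℕ) • ev ω (Function.update X t ⁅Y, X t⁆) := by
      rw [br_zero, ev_move h]
    have z : ∀ s : Fin (r + 1), ¬ (s.succ < 0) := fun s => by simp
    simp only [Fin.sum_univ_succ (n := r + 1), z, if_false, zero_add, lt_irrefl, bsum]
    simp only [Fin.succ_pos, if_true, m, e, ev_cons, Fin.cons_succ,
      Fin.cons_zero, Fin.removeNth_zero, Fin.tail_cons, Fin.val_zero, pow_zero, one_smul,
      Fin.val_succ, zero_add, smul_smul, pow_succ, mul_neg, mul_one, neg_mul, neg_smul,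
      Finset.sum_neg_distrib]
    simp only [← mul_pow, mul_neg, mul_one, neg_neg, one_pow, one_smul]
    abel

end CForm

end CForms

section CFinal

variable {𝔽 : Type*} [Field 𝔽] [CharZero 𝔽] {A : Type u} [CommRing A] [Algebra 𝔽 A]

open CForm

theorem cartanD_eq_C {r : ℕ} (F : (Fin r → Derivation 𝔽 A A) → A)
    (X : Fin (r + 1) → Derivation 𝔽 A A) :
    cartanD F X = ((r + 1 : 𝔽))⁻¹ • C F X := by
  have k (n : ℕ) (a : A) : (-1 : ℤ) ^ n • a = (-1 : A) ^ n * a := by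
    rw [zsmul_eq_mul]; push_cast; rfl
  simp only [C, k]
  rfl

theorem C_smul {r : ℕ} (c : 𝔽) (F : (Fin r → Derivation 𝔽 A A) → A)
    (X : Fin (r + 1) → Derivation 𝔽 A A) :
    C (fun X => c • F X) X = c • C F X := by
  have k (d : Derivation 𝔽 A A) (a : A) : ⁅d, c • a⁆ = c • ⁅d, a⁆ := d.map_smul c a
  simp only [C, smul_add, Finset.smul_sum, smul_ite, smul_zero, k, smul_comm c]

/-- An alternating map as an iterated additive map. -/
def toForm : (r : ℕ) → AlternatingMap A (Derivation 𝔽 A A) A (Fin r) →+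
    CForm (Derivation 𝔽 A A) A r
  | 0 => AddMonoidHom.mk' (fun ω => (ω Fin.elim0 : A)) (fun _ _ => rfl)
  | r + 1 => AddMonoidHom.mk' (fun ω => mk ((toForm r).comp ω.curryLeft.toAddMonoidHom))
      (fun a b => extAp fun Y => map_add (toForm r) (a.curryLeft Y) (b.curryLeft Y))

theorem ap_toForm {r : ℕ} (ω : AlternatingMap A (Derivation 𝔽 A A) A (Fin (r + 1)))
    (Y : Derivation 𝔽 A A) : ap (toForm (r + 1) ω) Y = toForm r (ω.curryLeft Y) := rfl

theorem ev_toForm : ∀ {r : ℕ} (ω : AlternatingMap A (Derivation 𝔽 A A) A (Fin r))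
    (X : Fin r → Derivation 𝔽 A A), ev (toForm r ω) X = ω X
  | 0, ω, X => by
      rw [Subsingleton.elim X Fin.elim0]
      rfl
  | r + 1, ω, X => by
      rw [ev, ap_toForm, ev_toForm]
      exact congrArg ω (Fin.cons_self_tail X)

theorem alt_toForm : ∀ {r : ℕ} (ω : AlternatingMap A (Derivation 𝔽 A A) A (Fin r)),
    Alt r (toForm r ω)
  | 0, _ => trivial
  | 1, _ => trivial
  | r + 2, ω => by
      refine ⟨fun Y => ?_, fun Y => alt_toForm (ω.curryLeft Y)⟩
      rw [ap_toForm, ap_toForm, AlternatingMap.curryLeft_same, map_zero]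

end CFinal

/-- The exterior differential squares to zero: for every alternating
`ω ∈ Ω^r`, applying the Cartan formula to `dω ∈ Ω^{r+1}` yields `d(dω) = 0` as a map
`𝔇^{r+2} → A`. -/
theorem cartanD_cartanD_eq_zero {𝔽 : Type*} [Field 𝔽] [CharZero 𝔽]
    {A : Type*} [CommRing A] [Algebra 𝔽 A] {r : ℕ}
    (ω : AlternatingMap A (Derivation 𝔽 A A) A (Fin r)) :
    ∀ X : Fin (r + 2) → Derivation 𝔽 A A, cartanD (cartanD (⇑ω)) X = 0 := by
  intro X
  have h : cartanD (⇑ω) = fun X => ((r + 1 : 𝔽))⁻¹ • CForm.ev (CForm.D r (toForm r ω)) X := by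
    funext Z
    rw [cartanD_eq_C, ← CForm.C_ev (alt_toForm ω), ← funext (ev_toForm ω)]
  rw [cartanD_eq_C, h, C_smul, CForm.C_ev (alt_toForm ω).D, CForm.D_D, CForm.ev_zero]
  simp
end

section
/- The Cartan magic formula holds: for every X ∈ 𝔇 and every ω ∈ Ω^r, L_X ω = d(i_X ω) + i_X(dω) as maps 𝔇^r → A. -/
/-- The argument tuple `(⁅Z_s, Z_t⁆, Z_0, …, Ẑ_s, …, Ẑ_t, …, Z_r)`. -/
def bracketArgs {𝔽 : Type*} [Field 𝔽]
    {A : Type*} [CommRing A] [Algebra 𝔽 A] {r : ℕ}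
    (Z : Fin (r + 1) → Derivation 𝔽 A A) (s t : Fin (r + 1)) : Fin r → Derivation 𝔽 A A :=
  fun u : Fin r =>
    if (u : ℕ) = 0 then ⁅Z s, Z t⁆
    else Z ⟨if (u : ℕ) - 1 < (s : ℕ) then (u : ℕ) - 1
            else if (u : ℕ) < (t : ℕ) then (u : ℕ) else (u : ℕ) + 1,
            by have h1 := u.isLt; split
               · omega
               · split <;> omega⟩

theorem cartanD_eq {𝔽 : Type*} [Field 𝔽] [CharZero 𝔽]
    {A : Type*} [CommRing A] [Algebra 𝔽 A] {r : ℕ}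
    (ω : (Fin r → Derivation 𝔽 A A) → A) (Z : Fin (r + 1) → Derivation 𝔽 A A) :
    cartanD ω Z = ((r + 1 : 𝔽))⁻¹ • (
      (∑ s : Fin (r + 1), (-1 : A) ^ (s : ℕ) * Z s (ω (s.removeNth Z))) +
      ∑ s : Fin (r + 1), ∑ t : Fin (r + 1),
        if s < t then (-1 : A) ^ ((s : ℕ) + (t : ℕ)) * ω (bracketArgs Z s t) else 0) := rfl

theorem iProdRaw_eq {𝔽 : Type*} [Field 𝔽] [CharZero 𝔽]
    {A : Type*} [CommRing A] [Algebra 𝔽 A] {r : ℕ} (X : Derivation 𝔽 A A)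
    (ω : (Fin (r + 1) → Derivation 𝔽 A A) → A) (Y : Fin r → Derivation 𝔽 A A) :
    iProdRaw X ω Y = ((r : A) + 1) * ω (Fin.cons X Y) := by
  unfold iProdRaw
  rw [Nat.cast_succ]
  congr 2
  funext u
  refine Fin.cases ?_ (fun i => ?_) u
  · simp
  · simp

theorem removeNth_succ_cons {α : Type*} {n : ℕ} (X : α) (Y : Fin (n + 1) → α) (s : Fin (n + 1)) :
    s.succ.removeNth (Fin.cons X Y : Fin (n + 2) → α)
      = (Fin.cons X (s.removeNth Y) : Fin (n + 1) → α) := by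
  funext u
  refine Fin.cases ?_ (fun i => ?_) u
  · simp [Fin.removeNth]
  · simp [Fin.removeNth]

theorem bracketArgs_zero {𝔽 : Type*} [Field 𝔽]
    {A : Type*} [CommRing A] [Algebra 𝔽 A] {n : ℕ} (X : Derivation 𝔽 A A)
    (Y : Fin (n + 1) → Derivation 𝔽 A A) (t : Fin (n + 1)) :
    bracketArgs (Fin.cons X Y : Fin (n + 2) → Derivation 𝔽 A A) 0 t.succ
      = (Fin.cons ⁅X, Y t⁆ (t.removeNth Y) : Fin (n + 1) → Derivation 𝔽 A A) := by
  funext u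
  refine Fin.cases ?_ (fun i => ?_) u
  · simp [bracketArgs]
  · have key : ∀ j : Fin (n + 2), j = (t.succAbove i).succ →
        (Fin.cons X Y : Fin (n + 2) → Derivation 𝔽 A A) j = Y (t.succAbove i) := by
      rintro _ rfl; simp
    simp only [bracketArgs, Fin.cons_succ, Fin.removeNth, Fin.val_succ, Nat.succ_ne_zero,
      if_false]
    apply key
    ext
    by_cases h : (i : ℕ) < (t : ℕ)
    · simp [Fin.succAbove, Fin.lt_def, h]
    · simp [Fin.succAbove, Fin.lt_def, h]

theorem bracketArgs_succ {𝔽 : Type*} [Field 𝔽]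
    {A : Type*} [CommRing A] [Algebra 𝔽 A] {n : ℕ}
    (ω : AlternatingMap A (Derivation 𝔽 A A) A (Fin (n + 1))) (X : Derivation 𝔽 A A)
    (Y : Fin (n + 1) → Derivation 𝔽 A A) (s t : Fin (n + 1)) (h : s < t) :
    ω (bracketArgs (Fin.cons X Y : Fin (n + 2) → Derivation 𝔽 A A) s.succ t.succ)
      = - ω (Fin.cons X (bracketArgs Y s t)) := by
  obtain _ | m := n
  · omega
  rw [← ω.map_swap _ (i := 0) (j := 1) (by simp)]
  congr 1
  funext u
  have key : ∀ (j : Fin (m + 3)) (k : Fin (m + 2)), (j : ℕ) = k + 1 →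
      (Fin.cons X Y : Fin (m + 3) → Derivation 𝔽 A A) j = Y k := by
    intro j k hjk
    obtain rfl : j = k.succ := by ext; simpa using hjk
    simp
  refine Fin.cases ?_ (fun i => ?_) u
  · simp only [Function.comp, Equiv.swap_apply_left]
    rw [show (1 : Fin (m + 2)) = Fin.succ 0 from rfl, Fin.cons_succ]
    simp [bracketArgs]
  · refine Fin.cases ?_ (fun i => ?_) i
    · rw [show Fin.succ (0 : Fin (m + 1)) = 1 from rfl]
      simp [bracketArgs, Function.comp]
    · rw [Function.comp, Equiv.swap_apply_of_ne_of_ne (by simp)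
        (by rw [Ne, Fin.ext_iff]; simp), Fin.cons_succ]
      simp only [bracketArgs, Fin.val_succ, Nat.succ_ne_zero, if_false]
      apply key
      simp only []
      split_ifs <;> omega

theorem map_update_cons {𝔽 : Type*} [Field 𝔽]
    {A : Type*} [CommRing A] [Algebra 𝔽 A] {n : ℕ}
    (ω : AlternatingMap A (Derivation 𝔽 A A) A (Fin (n + 1))) (Z : Derivation 𝔽 A A)
    (Y : Fin (n + 1) → Derivation 𝔽 A A) (s : Fin (n + 1)) :
    ω (Function.update Y s Z) = (-1 : A) ^ (s : ℕ) * ω (Fin.cons Z (s.removeNth Y)) := by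
  rw [← Fin.insertNth_removeNth, AlternatingMap.map_insertNth]
  simp [Matrix.vecCons, zsmul_eq_mul]

theorem natCast_mul_inv_smul {𝔽 : Type*} [Field 𝔽] [CharZero 𝔽]
    {A : Type*} [CommRing A] [Algebra 𝔽 A] (r : ℕ) (a : A) :
    ((r : A) + 1) * ((r + 1 : 𝔽)⁻¹ • a) = a := by
  have h : ((r : A) + 1) = algebraMap 𝔽 A ((r : 𝔽) + 1) := by simp
  rw [h, ← Algebra.smul_def, smul_smul, mul_inv_cancel₀ (Nat.cast_add_one_ne_zero r), one_smul]

/-- `i_X (dω)`, expanded. -/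
theorem iProdRaw_cartanD {𝔽 : Type*} [Field 𝔽] [CharZero 𝔽]
    {A : Type*} [CommRing A] [Algebra 𝔽 A] {n : ℕ}
    (ω : AlternatingMap A (Derivation 𝔽 A A) A (Fin (n + 1)))
    (X : Derivation 𝔽 A A) (Y : Fin (n + 1) → Derivation 𝔽 A A) :
    iProdRaw X (cartanD (⇑ω)) Y = X (ω Y)
      - (∑ s : Fin (n + 1), (-1 : A) ^ (s : ℕ) * Y s (ω (Fin.cons X (s.removeNth Y))))
      - (∑ s : Fin (n + 1), ω (Function.update Y s ⁅X, Y s⁆))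
      - ∑ s : Fin (n + 1), ∑ t : Fin (n + 1),
          if s < t then (-1 : A) ^ ((s : ℕ) + (t : ℕ)) * ω (Fin.cons X (bracketArgs Y s t))
          else 0 := by
  refine (iProdRaw_eq X (cartanD (⇑ω)) Y).trans ?_
  rw [cartanD_eq, natCast_mul_inv_smul, Fin.sum_univ_succ, Fin.sum_univ_succ (n := n + 1),
    Fin.sum_univ_succ (n := n + 1)]
  have h1 : ∀ s : Fin (n + 1), (∑ t : Fin (n + 2), if s.succ < t then
      (-1 : A) ^ ((s.succ : ℕ) + (t : ℕ)) *
        ω (bracketArgs (Fin.cons X Y : Fin (n + 2) → Derivation 𝔽 A A) s.succ t) else 0)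
      = - ∑ t : Fin (n + 1),
          if s < t then (-1 : A) ^ ((s : ℕ) + (t : ℕ)) * ω (Fin.cons X (bracketArgs Y s t))
          else 0 := by
    intro s
    rw [Fin.sum_univ_succ, ← Finset.sum_neg_distrib]
    simp only [Fin.not_lt_zero, if_false, zero_add, Fin.succ_lt_succ_iff]
    refine Finset.sum_congr rfl fun t _ => ?_
    split_ifs with h
    · rw [bracketArgs_succ ω X Y s t h]
      simp only [Fin.val_succ]
      ring
    · simp
  rw [Finset.sum_congr rfl fun s _ => h1 s]
  simp only [removeNth_succ_cons, bracketArgs_zero, map_update_cons, Fin.cons_zero,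
    Fin.cons_succ, Fin.succ_pos, if_true, Fin.val_succ, lt_irrefl, if_false, Fin.removeNth_zero,
    Fin.tail_cons, Fin.val_zero, pow_zero, one_mul, zero_add, pow_succ, mul_neg, neg_mul, mul_one,
    Finset.sum_neg_distrib]
  ring

/-- `d (i_X ω)`, expanded. -/
theorem cartanD_iProdRaw {𝔽 : Type*} [Field 𝔽] [CharZero 𝔽]
    {A : Type*} [CommRing A] [Algebra 𝔽 A] {n : ℕ}
    (ω : AlternatingMap A (Derivation 𝔽 A A) A (Fin (n + 1)))
    (X : Derivation 𝔽 A A) (Y : Fin (n + 1) → Derivation 𝔽 A A) :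
    cartanD (r := n) (iProdRaw X (⇑ω)) Y =
      (∑ s : Fin (n + 1), (-1 : A) ^ (s : ℕ) * Y s (ω (Fin.cons X (s.removeNth Y))))
      + ∑ s : Fin (n + 1), ∑ t : Fin (n + 1),
          if s < t then (-1 : A) ^ ((s : ℕ) + (t : ℕ)) * ω (Fin.cons X (bracketArgs Y s t))
          else 0 := by
  refine Eq.trans ?_ (natCast_mul_inv_smul (𝔽 := 𝔽) n _)
  rw [cartanD_eq, mul_smul_comm]
  congr 1
  have h (D : Derivation 𝔽 A A) (a : A) : D (((n : A) + 1) * a) = ((n : A) + 1) * D a := by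
    simp [Derivation.leibniz]
  rw [mul_add, Finset.mul_sum, Finset.mul_sum]
  congr 1
  · refine Finset.sum_congr rfl fun s _ => ?_
    rw [iProdRaw_eq, h]
    ring
  · refine Finset.sum_congr rfl fun s _ => ?_
    rw [Finset.mul_sum]
    refine Finset.sum_congr rfl fun t _ => ?_
    rw [iProdRaw_eq]
    split_ifs
    · ring
    · simp

/-- The Cartan magic formula: for every derivation `X ∈ 𝔇` and every
alternating `ω ∈ Ω^r`, `L_X ω = d(i_X ω) + i_X (dω)` as maps `𝔇^r → A`
(with the convention `i_X ω = 0`, hence `d(i_X ω) = 0`, when `r = 0`). -/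
theorem cartan_magic_formula {𝔽 : Type*} [Field 𝔽] [CharZero 𝔽]
    {A : Type*} [CommRing A] [Algebra 𝔽 A] (r : ℕ)
    (ω : AlternatingMap A (Derivation 𝔽 A A) A (Fin r))
    (X : Derivation 𝔽 A A) (Y : Fin r → Derivation 𝔽 A A) :
    lieDerivRaw X (⇑ω) Y =
      (if h : r = 0 then 0
        else cartanD (iProdRaw X (⇑ω))
          (fun u : Fin (r - 1 + 1) => Y (Fin.cast (by omega) u)))
      + iProdRaw X (cartanD (⇑ω)) Y := by
  obtain _ | n := r
  · rw [dif_pos rfl, zero_add]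
    refine Eq.trans ?_ (iProdRaw_eq X (cartanD (⇑ω)) Y).symm
    rw [cartanD_eq, natCast_mul_inv_smul]
    simp [lieDerivRaw]
  · rw [dif_neg (Nat.succ_ne_zero n), iProdRaw_cartanD]
    refine Eq.trans ?_ (congrArg (· + _) (cartanD_iProdRaw ω X Y).symm)
    simp only [lieDerivRaw]
    ring
end
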